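/- Let H ∈ (0,1) and let α_H be a fixed nonzero real constant. Define, for smooth compactly supported w : (−∞,0] → ℝ with w(0) = 0, the function (D_H w)(t) = α_H ∫_{−∞}^0 (−s)^{H−1/2} (ẇ(s+t) − ẇ(s)) ds for t ≤ 0. Then there exists a constant C > 0, depending only on H and α_H, such that ‖D_H w‖_{1−H} ≤ C ‖w‖_H for every such w. -/

import Mathlib

open MeasureTheory Set

/-- The set of difference quotients defining the Hölder-type norm `‖·‖_H`. -/
def holderSet (H : ℝ) (w : ℝ → ℝ) : Set ℝ :=
  {q | ∃ s t : ℝ, s ≤ 0 ∧ t ≤ 0 ∧ s ≠ t ∧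
    q = |w t - w s| / (|t - s| ^ ((1 - H) / 2) * (1 + |t| + |s|) ^ ((1 : ℝ) / 2))}

/-- The norm `‖w‖_H`. -/
noncomputable def normH (H : ℝ) (w : ℝ → ℝ) : ℝ := sSup (holderSet H w)

/-- The operator `D_H`, `(D_H w)(t) = α_H ∫_{-∞}^0 (-s)^{H-1/2} (ẇ(s+t) - ẇ(s)) ds`. -/
noncomputable def DH (H αH : ℝ) (w : ℝ → ℝ) : ℝ → ℝ := fun t =>
  αH * ∫ s in Set.Iio (0 : ℝ), ((-s) ^ (H - 1 / 2)) * (deriv w (s + t) - deriv w s)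

lemma ibp_bound {a b : ℝ} (hab : a ≤ b) (k k' g g' bd : ℝ → ℝ)
    (hc : ContinuousOn (fun u => k u * g u) (Icc a b))
    (hk : ∀ u ∈ Ioo a b, HasDerivAt k (k' u) u)
    (hg : ∀ u ∈ Ioo a b, HasDerivAt g (g' u) u)
    (hi : IntervalIntegrable (fun u => k u * g' u) volume a b)
    (hbd : IntervalIntegrable bd volume a b)
    (hle : ∀ u ∈ Ioc a b, |k' u * g u| ≤ bd u)
    (hm : AEStronglyMeasurable (fun u => k' u * g u) (volume.restrict (Ioc a b))) :
    |∫ u in a..b, k u * g' u| ≤ |k b * g b| + |k a * g a| + ∫ u in a..b, bd u := by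
  have hi2 : IntervalIntegrable (fun u => k' u * g u) volume a b := by
    refine hbd.mono_fun (by rwa [uIoc_of_le hab]) ?_
    rw [uIoc_of_le hab]
    refine (ae_restrict_iff' measurableSet_Ioc).2 (Filter.Eventually.of_forall fun u hu => ?_)
    exact (hle u hu).trans (le_abs_self _)
  have h1 := intervalIntegral.integral_eq_sub_of_hasDerivAt_of_le hab hc
    (fun u hu => (hk u hu).mul (hg u hu)) (hi2.add hi)
  rw [intervalIntegral.integral_add hi2 hi] at h1
  have h2 : |∫ u in a..b, k' u * g u| ≤ ∫ u in a..b, bd u := by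
    rw [← Real.norm_eq_abs]
    exact intervalIntegral.norm_integral_le_of_norm_le hab
      (Filter.Eventually.of_forall fun u hu => hle u hu) hbd
  have h3 : (∫ u in a..b, k u * g' u) = k b * g b - k a * g a - ∫ u in a..b, k' u * g u := by
    linarith
  rw [h3]
  have := abs_sub (k b * g b - k a * g a) (∫ u in a..b, k' u * g u)
  have := abs_sub (k b * g b) (k a * g a)
  linarith

lemma near_bound {β γ : ℝ} (hβ : -1 < β) (hσ : 0 < β + γ) {R M : ℝ} (hR : 0 < R)
    (g g' : ℝ → ℝ) (hg : ∀ u, HasDerivAt g (g' u) u) (hg' : Continuous g')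
    (hg0 : g 0 = 0) (hM : ∀ u, 0 < u → u ≤ R → |g u| ≤ M * u ^ γ) :
    |∫ u in (0:ℝ)..R, u ^ β * g' u| ≤ (1 + |β| / (β + γ)) * (M * R ^ (β + γ)) := by
  have hgc : Continuous g := continuous_iff_continuousAt.2 fun u => (hg u).continuousAt
  have key : ∀ u, 0 < u → u ≤ R → |u ^ β * g u| ≤ M * u ^ (β + γ) := by
    intro u hu huR
    rw [abs_mul, abs_of_pos (Real.rpow_pos_of_pos hu _), Real.rpow_add hu]
    have := mul_le_mul_of_nonneg_left (hM u hu huR) (Real.rpow_pos_of_pos hu β).le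
    linarith
  have h := ibp_bound hR.le (fun u => u ^ β) (fun u => β * u ^ (β - 1)) g g'
    (fun u => |β| * M * u ^ (β + γ - 1)) ?_ ?_ (fun u _ => hg u) ?_ ?_ ?_ ?_
  · refine h.trans ?_
    simp only [hg0, mul_zero, abs_zero, add_zero]
    rw [intervalIntegral.integral_const_mul, integral_rpow (Or.inl (by linarith)),
      sub_add_cancel, Real.zero_rpow hσ.ne', sub_zero]
    have := key R hR le_rfl
    have e : |β| * M * (R ^ (β + γ) / (β + γ)) = |β| / (β + γ) * (M * R ^ (β + γ)) := by ring
    rw [e]; linarith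
  · intro u hu
    rcases hu.1.eq_or_lt with h0 | h0
    · subst h0
      refine ContinuousWithinAt.mono (t := Iic R ∩ Ici 0) ?_ (fun x hx => ⟨hx.2, hx.1⟩)
      show Filter.Tendsto _ _ _
      simp only [hg0, mul_zero]
      have hz : Filter.Tendsto (fun u : ℝ => M * u ^ (β + γ)) (nhdsWithin 0 (Iic R ∩ Ici 0))
          (nhds 0) := by
        have : ContinuousAt (fun u : ℝ => M * u ^ (β + γ)) 0 :=
          continuousAt_const.mul (Real.continuousAt_rpow_const _ _ (Or.inr hσ.le))
        have h2 := this.tendsto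
        simp only [Real.zero_rpow hσ.ne', mul_zero] at h2
        exact h2.mono_left nhdsWithin_le_nhds
      refine squeeze_zero_norm' ?_ hz
      filter_upwards [self_mem_nhdsWithin] with x hx
      rcases (show (0:ℝ) ≤ x from hx.2).eq_or_lt with h0 | h0
      · subst h0; simp [hg0, Real.zero_rpow hσ.ne']
      · exact key x h0 hx.1
    · exact ((Real.continuousAt_rpow_const _ _ (Or.inl h0.ne')).mul
        hgc.continuousAt).continuousWithinAt
  · intro u hu
    exact Real.hasDerivAt_rpow_const (Or.inl hu.1.ne')
  · exact (intervalIntegral.intervalIntegrable_rpow' hβ).mul_continuousOn hg'.continuousOn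
  · exact (intervalIntegral.intervalIntegrable_rpow' (by linarith)).const_mul _
  · intro u hu
    rw [abs_mul, abs_mul, abs_of_pos (Real.rpow_pos_of_pos hu.1 _),
      show β + γ - 1 = (β - 1) + γ by ring, Real.rpow_add hu.1]
    have := mul_le_mul_of_nonneg_left (hM u hu.1 hu.2)
      (mul_nonneg (abs_nonneg β) (Real.rpow_pos_of_pos hu.1 (β - 1)).le)
    linarith
  · apply Measurable.aestronglyMeasurable
    have := hgc.measurable
    fun_prop

lemma rpow_diff {p h u : ℝ} (hp : p < 1) (hh : 0 < h) (hu : 2 * h ≤ u) :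
    |u ^ p - (u - h) ^ p| ≤ |p| * 2 ^ (1 - p) * h * u ^ (p - 1) := by
  have hu0 : 0 < u := by linarith
  obtain ⟨ξ, hξ, he⟩ := exists_hasDerivAt_eq_slope (fun x : ℝ => x ^ p)
    (fun x => p * x ^ (p - 1)) (a := u - h) (b := u) (by linarith)
    (fun x hx => (Real.continuousAt_rpow_const _ _
      (Or.inl (by have := hx.1; intro; linarith))).continuousWithinAt)
    (fun x hx => Real.hasDerivAt_rpow_const (Or.inl (by have := hx.1; intro; linarith)))
  have e : u ^ p - (u - h) ^ p = p * ξ ^ (p - 1) * h := by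
    rw [he]; simp only [sub_sub_cancel]; field_simp
  have hξ0 : u / 2 ≤ ξ := by have := hξ.1; linarith
  have hξp : 0 < ξ := by linarith
  have h1 : ξ ^ (p - 1) ≤ (u / 2) ^ (p - 1) :=
    Real.rpow_le_rpow_of_nonpos (by linarith) hξ0 (by linarith)
  have h2 : (u / 2) ^ (p - 1) = 2 ^ (1 - p) * u ^ (p - 1) := by
    rw [Real.div_rpow hu0.le (by norm_num), show (1 - p) = -(p - 1) by ring,
      Real.rpow_neg (by norm_num)]
    field_simp
  rw [e, abs_mul, abs_mul, abs_of_pos hh, abs_of_pos (Real.rpow_pos_of_pos hξp _)]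
  rw [h2] at h1
  have := mul_le_mul_of_nonneg_left h1 (mul_nonneg (abs_nonneg p) hh.le)
  linarith

lemma int_rpow_le {q h R : ℝ} (hq : q < -1) (hh : 0 < h) (hR : 2 * h ≤ R) :
    ∫ u in (2 * h)..R, u ^ q ≤ h ^ (q + 1) / (-(q + 1)) := by
  have h0 : (0:ℝ) ∉ uIcc (2 * h) R := by
    rw [uIcc_of_le hR]; intro hx; have := hx.1; linarith
  rw [integral_rpow (Or.inr ⟨hq.ne, h0⟩), ← neg_div_neg_eq]
  have h1 : 0 ≤ R ^ (q + 1) := Real.rpow_nonneg (by linarith) _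
  have h2 : (2 * h) ^ (q + 1) ≤ h ^ (q + 1) :=
    Real.rpow_le_rpow_of_nonpos hh (by linarith) (by linarith)
  exact div_le_div_of_nonneg_right (by linarith) (by linarith)

lemma far_bound {β γ : ℝ} (hβ : β < 1) (hσ : β + γ < 1 / 2) :
    ∃ C : ℝ, 0 < C ∧ ∀ (h R M N : ℝ) (g g' : ℝ → ℝ), 0 < h → 2 * h ≤ R → 0 ≤ M → 0 ≤ N →
      (∀ u, HasDerivAt g (g' u) u) → Continuous g' →
      (∀ u, 2 * h ≤ u → u ≤ R → |g u| ≤ M * u ^ γ + N * u ^ (γ + 1 / 2)) →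
      |∫ u in (2 * h)..R, (u ^ β - (u - h) ^ β) * g' u| ≤
        C * (M * h ^ (β + γ) + N * h ^ (β + γ + 1 / 2)) := by
  set K1 : ℝ := |β| * 2 ^ (1 - β) with hK1
  set K2 : ℝ := |β| * (|β - 1| * 2 ^ (1 - (β - 1))) with hK2
  have hK1p : 0 ≤ K1 := by positivity
  have hK2p : 0 ≤ K2 := by positivity
  have hd1 : 0 < 1 / (1 - (β + γ)) := by apply one_div_pos.2; linarith
  have hd2 : 0 < 1 / (1 / 2 - (β + γ)) := by apply one_div_pos.2; linarith
  set d1 := 1 / (1 - (β + γ)) with hdd1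
  set d2 := 1 / (1 / 2 - (β + γ)) with hdd2
  refine ⟨2 * K1 + K2 * (d1 + d2) + 1, by positivity, ?_⟩
  intro h R M N g g' hh hR hM hN hg hg' hb
  have hgc : Continuous g := continuous_iff_continuousAt.2 fun u => (hg u).continuousAt
  have kc : ∀ u ∈ Icc (2 * h) R, ContinuousAt (fun u : ℝ => u ^ β - (u - h) ^ β) u := by
    intro u hu
    have hu1 := hu.1
    refine (Real.continuousAt_rpow_const _ _ (Or.inl (by intro; linarith))).sub ?_
    exact ContinuousAt.rpow_const (by fun_prop) (Or.inl (by intro; linarith))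
  have bdry : ∀ u, 2 * h ≤ u → u ≤ R → |(u ^ β - (u - h) ^ β) * g u| ≤
      K1 * (M * h ^ (β + γ) + N * h ^ (β + γ + 1 / 2)) := by
    intro u h1 h2
    have hu0 : 0 < u := by linarith
    have hk := rpow_diff hβ hh h1
    rw [abs_mul]
    refine (mul_le_mul hk (hb u h1 h2) (abs_nonneg _) ((abs_nonneg _).trans hk)).trans ?_
    have e1 : u ^ (β - 1) * u ^ γ = u ^ (β + γ - 1) := by
      rw [← Real.rpow_add hu0]; ring_nf
    have e2 : u ^ (β - 1) * u ^ (γ + 1 / 2) = u ^ (β + γ + 1 / 2 - 1) := by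
      rw [← Real.rpow_add hu0]; ring_nf
    have f1 : u ^ (β + γ - 1) ≤ h ^ (β + γ - 1) :=
      Real.rpow_le_rpow_of_nonpos hh (by linarith) (by linarith)
    have f2 : u ^ (β + γ + 1 / 2 - 1) ≤ h ^ (β + γ + 1 / 2 - 1) :=
      Real.rpow_le_rpow_of_nonpos hh (by linarith) (by linarith)
    have g1 : h * h ^ (β + γ - 1) = h ^ (β + γ) := by
      rw [Real.rpow_sub_one hh.ne']; field_simp
    have g2 : h * h ^ (β + γ + 1 / 2 - 1) = h ^ (β + γ + 1 / 2) := by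
      rw [Real.rpow_sub_one hh.ne']; field_simp
    calc |β| * 2 ^ (1 - β) * h * u ^ (β - 1) * (M * u ^ γ + N * u ^ (γ + 1 / 2))
        = K1 * (M * (h * (u ^ (β - 1) * u ^ γ)) + N * (h * (u ^ (β - 1) * u ^ (γ + 1 / 2)))) := by
          rw [hK1]; ring
      _ ≤ K1 * (M * (h * h ^ (β + γ - 1)) + N * (h * h ^ (β + γ + 1 / 2 - 1))) := by
          rw [e1, e2]; gcongr
      _ = _ := by rw [g1, g2]
  have ii : ∀ q : ℝ, IntervalIntegrable (fun u : ℝ => u ^ q) volume (2 * h) R := by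
    intro q
    apply intervalIntegral.intervalIntegrable_rpow
    right
    rw [uIcc_of_le hR]; intro hx; have := hx.1; linarith
  have hmain := ibp_bound hR (fun u => u ^ β - (u - h) ^ β)
    (fun u => β * (u ^ (β - 1) - (u - h) ^ (β - 1))) g g'
    (fun u => K2 * h * (M * u ^ (β + γ - 2) + N * u ^ (β + γ - 3 / 2))) ?_ ?_ (fun u _ => hg u)
    ?_ ?_ ?_ ?_
  · refine hmain.trans ?_
    have b1 := bdry R hR le_rfl
    have b2 := bdry (2 * h) le_rfl hR
    rw [intervalIntegral.integral_const_mul, intervalIntegral.integral_add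
      ((ii _).const_mul _) ((ii _).const_mul _), intervalIntegral.integral_const_mul,
      intervalIntegral.integral_const_mul]
    have i1 := int_rpow_le (q := β + γ - 2) (by linarith) hh hR
    have i2 := int_rpow_le (q := β + γ - 3 / 2) (by linarith) hh hR
    have j1 : h * (h ^ (β + γ - 2 + 1) / (-(β + γ - 2 + 1))) = d1 * h ^ (β + γ) := by
      rw [show β + γ - 2 + 1 = β + γ - 1 by ring, Real.rpow_sub_one hh.ne', hdd1,
        show -(β + γ - 1) = 1 - (β + γ) by ring]
      field_simp
    have j2 : h * (h ^ (β + γ - 3 / 2 + 1) / (-(β + γ - 3 / 2 + 1)))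
        = d2 * h ^ (β + γ + 1 / 2) := by
      rw [show β + γ - 3 / 2 + 1 = β + γ + 1 / 2 - 1 by ring, Real.rpow_sub_one hh.ne', hdd2,
        show -(β + γ + 1 / 2 - 1) = 1 / 2 - (β + γ) by ring]
      field_simp
    set X := h ^ (β + γ) with hX
    set Y := h ^ (β + γ + 1 / 2) with hY
    have hXp : 0 ≤ X := by positivity
    have hYp : 0 ≤ Y := by positivity
    have k1 : K2 * h * (M * (∫ u in (2 * h)..R, u ^ (β + γ - 2)) +
        N * (∫ u in (2 * h)..R, u ^ (β + γ - 3 / 2))) ≤ K2 * (M * (d1 * X) + N * (d2 * Y)) := by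
      rw [← j1, ← j2]
      calc _ ≤ K2 * h * (M * (h ^ (β + γ - 2 + 1) / (-(β + γ - 2 + 1))) +
            N * (h ^ (β + γ - 3 / 2 + 1) / (-(β + γ - 3 / 2 + 1)))) := by gcongr
        _ = _ := by ring
    have k2 : K2 * (M * (d1 * X) + N * (d2 * Y)) ≤ K2 * (d1 + d2) * (M * X + N * Y) := by
      have : 0 ≤ K2 * (M * (d2 * X) + N * (d1 * Y)) := by positivity
      linarith
    have k3 : 0 ≤ M * X + N * Y := by positivity
    linarith
  · exact fun u hu => ((kc u hu).mul hgc.continuousAt).continuousWithinAt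
  · intro u hu
    have hu1 := hu.1
    have a1 : HasDerivAt (fun u : ℝ => u ^ β) (β * u ^ (β - 1)) u :=
      Real.hasDerivAt_rpow_const (Or.inl (by intro; linarith))
    have a2 : HasDerivAt (fun u : ℝ => (u - h) ^ β) (1 * β * (u - h) ^ (β - 1)) u :=
      ((hasDerivAt_id u).sub_const h).rpow_const (Or.inl (by simp only [id]; intro; linarith))
    have e : β * (u ^ (β - 1) - (u - h) ^ (β - 1)) =
        β * u ^ (β - 1) - 1 * β * (u - h) ^ (β - 1) := by ring
    rw [e]
    exact a1.sub a2
  · apply ContinuousOn.intervalIntegrable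
    rw [uIcc_of_le hR]
    exact fun u hu => ((kc u hu).mul hg'.continuousAt).continuousWithinAt
  · exact (((ii _).const_mul _).add ((ii _).const_mul _)).const_mul _
  · intro u hu
    have hu1 := hu.1.le
    have hu0 : 0 < u := by linarith
    have hk := rpow_diff (p := β - 1) (by linarith) hh hu1
    rw [abs_mul, abs_mul]
    have e1 : u ^ (β - 1 - 1) * u ^ γ = u ^ (β + γ - 2) := by
      rw [← Real.rpow_add hu0]; ring_nf
    have e2 : u ^ (β - 1 - 1) * u ^ (γ + 1 / 2) = u ^ (β + γ - 3 / 2) := by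
      rw [← Real.rpow_add hu0]; ring_nf
    calc |β| * |u ^ (β - 1) - (u - h) ^ (β - 1)| * |g u|
        ≤ |β| * (|β - 1| * 2 ^ (1 - (β - 1)) * h * u ^ (β - 1 - 1)) *
          (M * u ^ γ + N * u ^ (γ + 1 / 2)) := by
          gcongr
          exact hb u hu1 hu.2
      _ = K2 * h * (M * (u ^ (β - 1 - 1) * u ^ γ) + N * (u ^ (β - 1 - 1) * u ^ (γ + 1 / 2))) := by
          rw [hK2]; ring
      _ = _ := by rw [e1, e2]
  · apply Measurable.aestronglyMeasurable
    have := hgc.measurable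
    fun_prop

lemma holderSet_bdd {H : ℝ} (hH : H ∈ Set.Ioo (0 : ℝ) 1) {w : ℝ → ℝ}
    (hw : ContDiff ℝ (⊤ : ℕ∞) w) (hs : HasCompactSupport w) : BddAbove (holderSet H w) := by
  obtain ⟨L, hL⟩ := ContDiff.lipschitzWith_of_hasCompactSupport hs hw (by simp)
  obtain ⟨B, hB⟩ := hs.exists_bound_of_continuous hw.continuous
  refine ⟨L + 2 * B, ?_⟩
  rintro q ⟨s, t, hs0, ht0, hst, rfl⟩
  have hd : 0 < |t - s| := abs_pos.2 (sub_ne_zero.2 hst.symm)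
  have hB0 : 0 ≤ B := (norm_nonneg _).trans (hB 0)
  have h1 : |w t - w s| ≤ (L + 2 * B) * |t - s| ^ ((1 - H) / 2) := by
    rcases le_total |t - s| 1 with h | h
    · have a := hL.dist_le_mul t s
      rw [Real.dist_eq, Real.dist_eq] at a
      have b : |t - s| ≤ |t - s| ^ ((1 - H) / 2) :=
        Real.self_le_rpow_of_le_one hd.le h (by linarith [hH.1])
      have : (L:ℝ) * |t - s| ≤ L * |t - s| ^ ((1 - H) / 2) := by gcongr
      have : 0 ≤ 2 * B * |t - s| ^ ((1 - H) / 2) := by positivity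
      linarith
    · have b : 1 ≤ |t - s| ^ ((1 - H) / 2) := Real.one_le_rpow h (by linarith [hH.2])
      have a := abs_sub (w t) (w s)
      have := hB t
      have := hB s
      simp only [Real.norm_eq_abs] at *
      have : (L + 2 * B) * 1 ≤ (L + 2 * B) * |t - s| ^ ((1 - H) / 2) := by gcongr
      have := L.2
      have : (0:ℝ) ≤ L := L.2
      linarith
  have h2 : (1:ℝ) ≤ (1 + |t| + |s|) ^ ((1 : ℝ) / 2) :=
    Real.one_le_rpow (by linarith [abs_nonneg t, abs_nonneg s]) (by norm_num)
  have hL0 : (0:ℝ) ≤ L := L.2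
  rw [div_le_iff₀ (by positivity)]
  refine h1.trans ?_
  have : 0 ≤ (L + 2 * B) * |t - s| ^ ((1 - H) / 2) := by positivity
  nlinarith

lemma normH_bound {H : ℝ} (hH : H ∈ Set.Ioo (0 : ℝ) 1) {w : ℝ → ℝ}
    (hw : ContDiff ℝ (⊤ : ℕ∞) w) (hs : HasCompactSupport w) {s t : ℝ} (h0 : s ≤ 0) (h1 : t ≤ 0) :
    |w t - w s| ≤ normH H w * |t - s| ^ ((1 - H) / 2) * (1 + |t| + |s|) ^ ((1 : ℝ) / 2) := by
  rcases eq_or_ne s t with h | h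
  · subst h
    have : (1 - H) / 2 ≠ 0 := by have := hH.2; intro; linarith
    simp [Real.zero_rpow this]
  · have hd : 0 < |t - s| := abs_pos.2 (sub_ne_zero.2 h.symm)
    have := le_csSup (holderSet_bdd hH hw hs) ⟨s, t, h0, h1, h, rfl⟩
    rw [div_le_iff₀ (by positivity)] at this
    rw [mul_assoc]; exact this

lemma normH_nonneg (H : ℝ) (w : ℝ → ℝ) : 0 ≤ normH H w := by
  apply Real.sSup_nonneg
  rintro q ⟨s, t, _, _, _, rfl⟩
  positivity

/-- the one-sided integral, rewritten over a finite interval -/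
lemma F_eq {β : ℝ} (hβ : -1 < β) {f : ℝ → ℝ} (hf : Continuous f) {ρ : ℝ} (hρ : 0 ≤ ρ)
    (hz : ∀ x, x < -ρ → f x = 0) {t : ℝ} (ht : t ≤ 0) {R : ℝ} (hR : ρ ≤ R) :
    IntegrableOn (fun s => (-s) ^ β * f (s + t)) (Iio 0) ∧
    ∫ s in Iio (0:ℝ), (-s) ^ β * f (s + t) = ∫ u in (0:ℝ)..R, u ^ β * f (t - u) := by
  have hi : IntegrableOn (fun u => u ^ β * f (t - u)) (Ioi 0) := by
    have h1 : IntegrableOn (fun u => u ^ β * f (t - u)) (Ioc 0 R) := by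
      rw [← intervalIntegrable_iff_integrableOn_Ioc_of_le (hρ.trans hR)]
      exact (intervalIntegral.intervalIntegrable_rpow' hβ).mul_continuousOn
        (by fun_prop)
    have h2 : IntegrableOn (fun u => u ^ β * f (t - u)) (Ioi R) := by
      refine (integrableOn_zero (s := Ioi R)).congr_fun (fun u hu => ?_) measurableSet_Ioi
      have : R < u := hu
      simp [hz (t - u) (by linarith)]
    rw [← Ioc_union_Ioi_eq_Ioi (hρ.trans hR)]
    exact h1.union h2
  have he : (fun s : ℝ => (-s) ^ β * f (s + t)) = fun s => (fun u => u ^ β * f (t - u)) (-s) := by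
    funext s; simp only [sub_neg_eq_add, add_comm]
  constructor
  · rw [he, ← integrableOn_Iic_iff_integrableOn_Iio]
    have h3 : IntegrableOn (fun u => u ^ β * f (t - u)) (Ici (-0)) := by
      rw [neg_zero, integrableOn_Ici_iff_integrableOn_Ioi]
      exact hi
    exact h3.comp_neg_Iic
  · rw [he, ← integral_Iic_eq_integral_Iio,
      integral_comp_neg_Iic 0 (fun u => u ^ β * f (t - u)), neg_zero,
      intervalIntegral.integral_of_le (hρ.trans hR)]
    refine (setIntegral_eq_of_subset_of_forall_sdiff_eq_zero measurableSet_Ioi Ioc_subset_Ioi_self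
      ?_)
    rintro u ⟨hu, hu2⟩
    have : R < u := by
      by_contra hc
      exact hu2 ⟨hu, not_lt.1 hc⟩
    simp [hz (t - u) (by linarith)]

lemma main_bound {H : ℝ} (hH : H ∈ Set.Ioo (0 : ℝ) 1) :
    ∃ C : ℝ, 0 < C ∧ ∀ w : ℝ → ℝ, ContDiff ℝ (⊤ : ℕ∞) w → HasCompactSupport w →
      ∀ t' t : ℝ, t' < t → t ≤ 0 →
      |(∫ s in Iio (0:ℝ), (-s) ^ (H - 1 / 2) * deriv w (s + t)) -
        ∫ s in Iio (0:ℝ), (-s) ^ (H - 1 / 2) * deriv w (s + t')| ≤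
      C * normH H w * ((t - t') ^ (H / 2) * (1 + |t| + |t'|) ^ ((1 : ℝ) / 2)) := by
  obtain ⟨hH0, hH1⟩ := hH
  set β := H - 1 / 2 with hβ
  set γ := (1 - H) / 2 with hγ
  have hσ : β + γ = H / 2 := by rw [hβ, hγ]; ring
  obtain ⟨C2, hC2, far⟩ := far_bound (β := β) (γ := γ) (by linarith) (by linarith)
  set C1 := 1 + |β| / (β + γ) with hC1
  have hC1p : 0 < C1 := by
    have : 0 ≤ |β| / (β + γ) := div_nonneg (abs_nonneg _) (by linarith)
    linarith
  refine ⟨6 * C1 + 3 * C2, by positivity, ?_⟩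
  intro w hw hs t' t htt ht0
  set N := normH H w with hN
  have hN0 : 0 ≤ N := normH_nonneg H w
  set h := t - t' with hh
  have hhp : 0 < h := by linarith
  set S := 1 + |t| + |t'| with hS
  have hSt : S = 1 - t - t' := by
    rw [hS, abs_of_nonpos ht0, abs_of_nonpos (by linarith : t' ≤ 0)]; ring
  have hSp : 0 < S := by linarith
  have hdc : Continuous (deriv w) := hw.continuous_deriv (by simp)
  have hwd : ∀ x, HasDerivAt w (deriv w x) x := fun x =>
    (hw.differentiable (by simp) x).hasDerivAt
  obtain ⟨ρ, hρ, hz⟩ : ∃ ρ : ℝ, 0 ≤ ρ ∧ ∀ x, x < -ρ → deriv w x = 0 := by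
    obtain ⟨r, hr⟩ := hs.deriv.isCompact.isBounded.subset_closedBall (0:ℝ)
    refine ⟨max r 0, le_max_right _ _, fun x hx => ?_⟩
    by_contra hne
    have := hr (subset_tsupport _ hne)
    rw [Metric.mem_closedBall, dist_zero_right, Real.norm_eq_abs] at this
    have := neg_le_abs x
    have := le_max_left r 0
    linarith
  have hβ1 : -1 < β := by rw [hβ]; linarith
  set R := ρ + 2 * h with hR
  rw [(F_eq hβ1 hdc hρ hz ht0 (R := R) (by linarith)).2,
    (F_eq hβ1 hdc hρ hz (by linarith : t' ≤ 0) (R := R - h) (by linarith)).2]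
  have ii : ∀ x a b : ℝ, IntervalIntegrable (fun u : ℝ => u ^ β * deriv w (x - u)) volume a b :=
    fun x a b => (intervalIntegral.intervalIntegrable_rpow' hβ1).mul_continuousOn (by fun_prop)
  have ii2 : IntervalIntegrable (fun u : ℝ => (u - h) ^ β * deriv w (t - u)) volume (2 * h) R := by
    have := (ii t' h (R - h)).comp_sub_right h
    convert this using 1
    · funext u; congr 2; rw [hh]; ring
    · ring
    · ring
  have sh : ∫ u in h..(R - h), u ^ β * deriv w (t' - u) =
      ∫ u in (2 * h)..R, (u - h) ^ β * deriv w (t - u) := by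
    have := intervalIntegral.integral_comp_sub_right (a := 2 * h) (b := R)
      (fun u : ℝ => u ^ β * deriv w (t' - u)) h
    rw [show 2 * h - h = h by ring] at this
    rw [← this]
    congr 1; funext u; congr 2; rw [hh]; ring
  have dec : (∫ u in (0:ℝ)..R, u ^ β * deriv w (t - u)) -
      (∫ u in (0:ℝ)..(R - h), u ^ β * deriv w (t' - u)) =
      (∫ u in (0:ℝ)..(2 * h), u ^ β * deriv w (t - u)) -
      (∫ u in (0:ℝ)..h, u ^ β * deriv w (t' - u)) +
      ∫ u in (2 * h)..R, (u ^ β - (u - h) ^ β) * deriv w (t - u) := by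
    have e : ∫ u in (2 * h)..R, (u ^ β - (u - h) ^ β) * deriv w (t - u) =
        (∫ u in (2 * h)..R, u ^ β * deriv w (t - u)) -
        ∫ u in (2 * h)..R, (u - h) ^ β * deriv w (t - u) := by
      rw [← intervalIntegral.integral_sub (ii _ _ _) ii2]
      congr 1; funext u; ring
    rw [e, ← sh, ← intervalIntegral.integral_add_adjacent_intervals (ii t 0 (2 * h)) (ii t _ R),
      ← intervalIntegral.integral_add_adjacent_intervals (ii t' 0 h) (ii t' _ (R - h))]
    ring
  have gd : ∀ x u : ℝ, HasDerivAt (fun u => w x - w (x - u)) (deriv w (x - u)) u := by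
    intro x u
    have h1 : HasDerivAt (fun u => x - u) (-1) u := by
      simpa using (hasDerivAt_id u).const_sub x
    have := ((hwd (x - u)).comp u h1).const_sub (w x)
    have e : deriv w (x - u) = -(deriv w (x - u) * -1) := by ring
    rw [e]
    exact this
  have gb : ∀ x u : ℝ, x ≤ 0 → 0 < u →
      |w x - w (x - u)| ≤ N * u ^ γ * (1 + 2 * (-x) + u) ^ ((1:ℝ) / 2) := by
    intro x u hx hu
    have := normH_bound ⟨hH0, hH1⟩ hw hs (s := x - u) (t := x) (by linarith) hx
    rw [sub_sub_cancel, abs_of_pos hu, abs_of_nonpos hx,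
      abs_of_nonpos (by linarith : x - u ≤ 0)] at this
    convert this using 3
    ring
  have s4 : (4 * S) ^ ((1:ℝ) / 2) = 2 * S ^ ((1:ℝ) / 2) := by
    rw [Real.mul_rpow (by norm_num) hSp.le, show (4:ℝ) = 2 ^ (2:ℝ) by norm_num,
      ← Real.rpow_mul (by norm_num)]
    norm_num
  set Q := S ^ ((1:ℝ) / 2) with hQ
  have hQ0 : 0 ≤ Q := by positivity
  have nb : ∀ x r : ℝ, x ≤ 0 → 0 < r → 1 + 2 * (-x) + r ≤ 4 * S → 
      |∫ u in (0:ℝ)..r, u ^ β * deriv w (x - u)| ≤ C1 * (N * (2 * Q) * r ^ (β + γ)) := by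
    intro x r hx hr hle
    refine near_bound hβ1 (by linarith) hr (fun u => w x - w (x - u)) (fun u => deriv w (x - u))
      (gd x) (by fun_prop) (by simp) ?_
    intro u hu hur
    refine (gb x u hx hu).trans ?_
    have : (1 + 2 * (-x) + u) ^ ((1:ℝ) / 2) ≤ 2 * Q := by
      rw [← s4]
      exact Real.rpow_le_rpow (by linarith) (by linarith) (by norm_num)
    calc _ ≤ N * u ^ γ * (2 * Q) := by gcongr
      _ = _ := by ring
  have n1 := nb t (2 * h) ht0 (by linarith) (by linarith)
  have n2 := nb t' h (by linarith) hhp (by linarith)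
  have n3 := far h R (N * (2 * Q)) N (fun u => w t - w (t - u)) (fun u => deriv w (t - u)) hhp
    (by linarith) (by positivity) hN0 (gd t) (by fun_prop) (by
      intro u hu _
      have hu0 : 0 < u := by linarith
      refine (gb t u ht0 hu0).trans ?_
      have : (1 + 2 * (-t) + u) ^ ((1:ℝ) / 2) ≤ 2 * Q + u ^ ((1:ℝ) / 2) := by
        rw [← s4]
        refine (Real.rpow_le_rpow (by linarith) (by linarith : _ ≤ 4 * S + u)
          (by norm_num)).trans ?_
        exact Real.rpow_add_le_add_rpow (by linarith) hu0.le (by norm_num) (by norm_num)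
      rw [Real.rpow_add hu0]
      calc _ ≤ N * u ^ γ * (2 * Q + u ^ ((1:ℝ) / 2)) := by gcongr
        _ = _ := by ring)
  rw [dec]
  rw [hσ] at n1 n2 n3
  set X := h ^ (H / 2) with hX
  have hX0 : 0 ≤ X := by positivity
  have p1 : (2 * h) ^ (H / 2) ≤ 2 * X := by
    rw [Real.mul_rpow (by norm_num) hhp.le]
    have : (2:ℝ) ^ (H / 2) ≤ 2 ^ (1:ℝ) :=
      Real.rpow_le_rpow_of_exponent_le (by norm_num) (by linarith)
    rw [Real.rpow_one] at this
    gcongr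
  have p2 : h ^ (H / 2 + 1 / 2) ≤ X * Q := by
    rw [Real.rpow_add hhp]
    have : h ^ ((1:ℝ) / 2) ≤ Q := Real.rpow_le_rpow hhp.le (by linarith) (by norm_num)
    gcongr
  have q1 : C1 * (N * (2 * Q) * (2 * h) ^ (H / 2)) ≤ C1 * (N * (2 * Q) * (2 * X)) := by gcongr
  have q2 : C2 * (N * (2 * Q) * X + N * h ^ (H / 2 + 1 / 2)) ≤
      C2 * (N * (2 * Q) * X + N * (X * Q)) := by gcongr
  refine (abs_add_le _ _).trans ?_
  refine (add_le_add_left (abs_sub _ _) _).trans ?_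
  linarith

/-- `D_H` is bounded from `(H_H, ‖·‖_H)` to `(H_{1-H}, ‖·‖_{1-H})` on smooth
compactly supported functions vanishing at `0`. -/
theorem stmt1 (H αH : ℝ) (hH : H ∈ Set.Ioo (0 : ℝ) 1) (hαH : αH ≠ 0) :
    ∃ C : ℝ, 0 < C ∧ ∀ w : ℝ → ℝ, ContDiff ℝ (⊤ : ℕ∞) w → HasCompactSupport w → w 0 = 0 →
      normH (1 - H) (DH H αH w) ≤ C * normH H w := by
  obtain ⟨C, hC, hb⟩ := main_bound hH
  have ha : 0 < |αH| := abs_pos.2 hαH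
  refine ⟨|αH| * C, by positivity, ?_⟩
  intro w hw hs _
  have hN0 : 0 ≤ normH H w := normH_nonneg H w
  have hdc : Continuous (deriv w) := hw.continuous_deriv (by simp)
  obtain ⟨ρ, hρ, hz⟩ : ∃ ρ : ℝ, 0 ≤ ρ ∧ ∀ x, x < -ρ → deriv w x = 0 := by
    obtain ⟨r, hr⟩ := hs.deriv.isCompact.isBounded.subset_closedBall (0:ℝ)
    refine ⟨max r 0, le_max_right _ _, fun x hx => ?_⟩
    by_contra hne
    have := hr (subset_tsupport _ hne)
    rw [Metric.mem_closedBall, dist_zero_right, Real.norm_eq_abs] at this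
    have := neg_le_abs x
    have := le_max_left r 0
    linarith
  have hβ1 : -1 < H - 1 / 2 := by linarith [hH.1]
  have hD : ∀ t ≤ 0, DH H αH w t = αH * ((∫ s in Iio (0:ℝ), (-s) ^ (H - 1 / 2) * deriv w (s + t)) -
      ∫ s in Iio (0:ℝ), (-s) ^ (H - 1 / 2) * deriv w (s + 0)) := by
    intro t ht
    rw [← integral_sub (F_eq hβ1 hdc hρ hz ht le_rfl).1 (F_eq hβ1 hdc hρ hz le_rfl le_rfl).1]
    simp only [DH, add_zero, mul_sub]
  have key : ∀ t' t : ℝ, t' < t → t ≤ 0 → |DH H αH w t - DH H αH w t'| ≤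
      |αH| * C * normH H w * (|t - t'| ^ (H / 2) * (1 + |t| + |t'|) ^ ((1 : ℝ) / 2)) := by
    intro t' t h1 h2
    rw [hD t h2, hD t' (by linarith), ← mul_sub, sub_sub_sub_cancel_right, abs_mul,
      abs_of_pos (sub_pos.2 h1)]
    have := mul_le_mul_of_nonneg_left (hb w hw hs t' t h1 h2) ha.le
    linarith
  apply Real.sSup_le
  · rintro q ⟨s, t, hs0, ht0, hst, rfl⟩
    have hd : 0 < |t - s| := abs_pos.2 (sub_ne_zero.2 hst.symm)
    rw [div_le_iff₀ (by positivity), sub_sub_cancel]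
    rcases lt_or_gt_of_ne hst with h | h
    · exact key s t h ht0
    · have := key t s h hs0
      rw [abs_sub_comm, abs_sub_comm t s, add_right_comm]
      exact this
  · positivity
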